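/- arXiv:1412.8252 — 2 statements merged into one kernel-verified Lean document; each statement's English description precedes it below -/
import Mathlib

section
/- For every real ν with |ν| > 1, one has p_l^m(ν) ≠ 0 for every l ≥ m, and the sequence g_l^m(ν)/p_l^m(ν) converges as l → ∞ to Λ^m(ν); that is, Λ^m(ν) = lim_{l→∞} g_l^m(ν)/p_l^m(ν). -/
open MeasureTheory Filter

/-- Legendre polynomial via Rodrigues' formula. -/
noncomputable def legendreP (l : ℕ) (x : ℝ) : ℝ :=
  (1 / (2 ^ l * (Nat.factorial l : ℝ))) *
    iteratedDeriv l (fun y : ℝ => (y ^ 2 - 1) ^ l) x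

/-- `p_l^m(μ) = √((l−m)!/(l+m)!) (d/dμ)^m P_l(μ)`; it vanishes for `l < m`
(in particular the convention `p_{m−1}^m = 0` holds). -/
noncomputable def pml (m l : ℕ) (μ : ℝ) : ℝ :=
  Real.sqrt ((Nat.factorial (l - m) : ℝ) / (Nat.factorial (l + m) : ℝ)) *
    iteratedDeriv m (legendreP l) μ

/-- `q_l^m(w) = (1/2) ∫_{−1}^{1} p_l^m(μ)/(w−μ) (1−μ²)^m dμ`. -/
noncomputable def qml (m l : ℕ) (w : ℝ) : ℝ :=
  (1 / 2) * ∫ μ in (-1 : ℝ)..1, pml m l μ / (w - μ) * (1 - μ ^ 2) ^ m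

/-- `h_l = 2l+1 − ϖ β_l` for `l ≤ L`, and `h_l = 2l+1` for `l > L`. -/
noncomputable def hcoef (ϖ : ℝ) (β : ℕ → ℝ) (L l : ℕ) : ℝ :=
  if l ≤ L then 2 * l + 1 - ϖ * β l else 2 * l + 1

/-- Auxiliary recursion: `chandraAux ϖ β L m ν n = g_{m+n}^m(ν)`, built from the
initial value `g_m^m(ν) = √((2m)!)/(2^m m!)`, the convention `g_{m−1}^m = 0`, and the
three-term recurrence `ν h_l g_l^m = √((l+1)²−m²) g_{l+1}^m + √(l²−m²) g_{l−1}^m`. -/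
noncomputable def chandraAux (ϖ : ℝ) (β : ℕ → ℝ) (L m : ℕ) (ν : ℝ) : ℕ → ℝ
  | 0 => Real.sqrt (Nat.factorial (2 * m)) / (2 ^ m * Nat.factorial m)
  | 1 => ν * hcoef ϖ β L m *
      (Real.sqrt (Nat.factorial (2 * m)) / (2 ^ m * Nat.factorial m)) /
      Real.sqrt (((m : ℝ) + 1) ^ 2 - (m : ℝ) ^ 2)
  | n + 2 =>
      (ν * hcoef ϖ β L (m + n + 1) * chandraAux ϖ β L m ν (n + 1) -
          Real.sqrt (((m + n + 1 : ℕ) : ℝ) ^ 2 - (m : ℝ) ^ 2) * chandraAux ϖ β L m ν n) /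
        Real.sqrt (((m + n + 2 : ℕ) : ℝ) ^ 2 - (m : ℝ) ^ 2)

/-- The normalized Chandrasekhar polynomial `g_l^m(ν)` (with value `0` for `l < m`). -/
noncomputable def gml (ϖ : ℝ) (β : ℕ → ℝ) (L m l : ℕ) (ν : ℝ) : ℝ :=
  if l < m then 0 else chandraAux ϖ β L m ν (l - m)

/-- `g^m(ν,μ) = Σ_{l=m}^{L} β_l p_l^m(μ) g_l^m(ν)`. -/
noncomputable def gfun (ϖ : ℝ) (β : ℕ → ℝ) (L m : ℕ) (ν μ : ℝ) : ℝ :=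
  ∑ l ∈ Finset.Icc m L, β l * pml m l μ * gml ϖ β L m l ν

/-- `Λ^m(w) = 1 − (ϖ w/2) ∫_{−1}^{1} g^m(w,μ)/(w−μ) (1−μ²)^m dμ`. -/
noncomputable def Lam (ϖ : ℝ) (β : ℕ → ℝ) (L m : ℕ) (w : ℝ) : ℝ :=
  1 - ϖ * w / 2 * ∫ μ in (-1 : ℝ)..1, gfun ϖ β L m w μ / (w - μ) * (1 - μ ^ 2) ^ m

/-- The off-diagonal entry `b_l = √((l²−m²)/(h_l h_{l−1}))`. -/
noncomputable def bcoef (ϖ : ℝ) (β : ℕ → ℝ) (L m l : ℕ) : ℝ :=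
  Real.sqrt (((l : ℝ) ^ 2 - (m : ℝ) ^ 2) / (hcoef ϖ β L l * hcoef ϖ β L (l - 1)))

/-- The symmetric tridiagonal matrix `B(m)` with rows/columns indexed by
`l ∈ {m, …, l_B}` (here `l = m + i` for `i : Fin (l_B − m + 1)`), zero diagonal and
off-diagonal entries `B(m)_{l,l−1} = B(m)_{l−1,l} = b_l`. -/
noncomputable def Bmat (ϖ : ℝ) (β : ℕ → ℝ) (L m lB : ℕ) :
    Matrix (Fin (lB - m + 1)) (Fin (lB - m + 1)) ℝ :=
  fun i j =>
    if (i : ℕ) + 1 = (j : ℕ) then bcoef ϖ β L m (m + j)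
    else if (j : ℕ) + 1 = (i : ℕ) then bcoef ϖ β L m (m + i)
    else 0


section LegendrePolynomials

open Polynomial

/-- The normalizing constant `1 / (2^l l!)` in Rodrigues' formula. -/
noncomputable def rodriguesCoeff (l : ℕ) : ℝ := 1 / (2 ^ l * (Nat.factorial l : ℝ))

/-- The `m`-th derivative of the `l`-th Legendre polynomial, as a polynomial. -/
noncomputable def legendreDeriv (m l : ℕ) : ℝ[X] :=
  derivative^[m] (C (rodriguesCoeff l) * derivative^[l] ((X ^ 2 - 1) ^ l))

/-- A primitive of the Legendre polynomial of degree `l + 1`. -/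
noncomputable def legendrePrimitive (l : ℕ) : ℝ[X] :=
  C (rodriguesCoeff (l + 1)) * derivative^[l] ((X ^ 2 - 1) ^ (l + 1))

theorem rodriguesCoeff_succ (l : ℕ) :
    rodriguesCoeff (l + 1) * (2 * (l + 1)) = rodriguesCoeff l := by
  unfold rodriguesCoeff
  have := Nat.factorial_ne_zero l
  rw [Nat.factorial_succ]
  push_cast
  field_simp
  ring

theorem iterate_derivative_X_mul_succ (p : ℝ[X]) (n : ℕ) :
    derivative^[n + 1] (X * p) =
      X * derivative^[n + 1] p + ((n : ℝ[X]) + 1) * derivative^[n] p := by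
  induction n with
  | zero => simp; ring
  | succ n ih =>
    rw [Function.iterate_succ_apply', ih, Function.iterate_succ_apply' _ (n + 1) p,
      Function.iterate_succ_apply' _ n p]
    simp only [derivative_add, derivative_mul, derivative_X, derivative_natCast, derivative_one]
    push_cast
    ring

theorem legendreDeriv_succ (m l : ℕ) :
    legendreDeriv (m + 1) l = derivative (legendreDeriv m l) :=
  Function.iterate_succ_apply' _ _ _

theorem derivative_legendrePrimitive (l : ℕ) :
    derivative (legendrePrimitive l) = legendreDeriv 0 (l + 1) := by
  simp [legendrePrimitive, legendreDeriv, Function.iterate_succ_apply']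

theorem derivative_X_sq_sub_one_pow (l : ℕ) :
    derivative ((X ^ 2 - 1 : ℝ[X]) ^ (l + 1)) =
      C (2 * ((l : ℝ) + 1)) * (X * (X ^ 2 - 1) ^ l) := by
  simp [derivative_pow]
  ring

theorem legendreDeriv_zero_zero : legendreDeriv 0 0 = 1 := by
  simp [legendreDeriv, rodriguesCoeff]

theorem legendreDeriv_zero_one : legendreDeriv 0 1 = X := by
  have h := derivative_X_sq_sub_one_pow 0
  simp only [zero_add] at h
  simp only [legendreDeriv, Function.iterate_zero, id, Function.iterate_one, h, ← mul_assoc, ← C_mul]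
  norm_num [rodriguesCoeff]

theorem legendreDeriv_zero_add_two (l : ℕ) :
    legendreDeriv 0 (l + 2) =
      X * legendreDeriv 0 (l + 1) + ((l : ℝ[X]) + 1) * legendrePrimitive l := by
  have h : legendreDeriv 0 (l + 2) =
      C (rodriguesCoeff (l + 1)) * derivative^[l + 1] (X * (X ^ 2 - 1) ^ (l + 1)) := by
    rw [legendreDeriv, Function.iterate_zero, id, Function.iterate_succ_apply,
      derivative_X_sq_sub_one_pow, iterate_derivative_C_mul, ← mul_assoc, ← C_mul,
      rodriguesCoeff_succ]
  rw [h, iterate_derivative_X_mul_succ, legendreDeriv, legendrePrimitive, Function.iterate_zero, id]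
  ring

theorem legendreDeriv_zero_add_two_sub (l : ℕ) :
    legendreDeriv 0 (l + 2) =
      legendreDeriv 0 l + (2 * (l : ℝ[X]) + 3) * legendrePrimitive l := by
  have h : derivative (derivative ((X ^ 2 - 1 : ℝ[X]) ^ (l + 2))) =
      C (2 * (((l + 1 : ℕ) : ℝ) + 1)) * (C (2 * (l : ℝ) + 3) * (X ^ 2 - 1) ^ (l + 1) +
        C (2 * ((l : ℝ) + 1)) * (X ^ 2 - 1) ^ l) := by
    rw [derivative_X_sq_sub_one_pow, derivative_C_mul, derivative_mul,
      derivative_X_sq_sub_one_pow]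
    simp only [derivative_X, map_add, map_mul, map_natCast, map_ofNat, map_one]
    ring
  rw [legendreDeriv, Function.iterate_zero, id, Function.iterate_succ_apply,
    Function.iterate_succ_apply, h, iterate_derivative_C_mul, iterate_map_add,
    iterate_derivative_C_mul, iterate_derivative_C_mul, ← mul_assoc, ← C_mul,
    rodriguesCoeff_succ, legendreDeriv, legendrePrimitive, Function.iterate_zero, id,
    mul_add, ← rodriguesCoeff_succ l]
  simp only [map_add, map_mul, map_natCast, map_ofNat, map_one]
  ring

theorem legendreDeriv_succ_succ (j l : ℕ) :
    legendreDeriv (j + 1) (l + 1) =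
      X * legendreDeriv (j + 1) l + ((l : ℝ[X]) + 1 + (j : ℝ[X])) * legendreDeriv j l := by
  induction j with
  | zero =>
    cases l with
    | zero =>
      simp [legendreDeriv_succ, legendreDeriv_zero_zero, legendreDeriv_zero_one]
    | succ l =>
      have h := congrArg derivative (legendreDeriv_zero_add_two l)
      simp only [derivative_add, derivative_mul, derivative_X, derivative_natCast, derivative_one,
        derivative_legendrePrimitive, ← legendreDeriv_succ] at h
      push_cast
      linear_combination h
  | succ j ih =>
    have h := congrArg derivative ih
    simp only [derivative_add, derivative_mul, derivative_X, derivative_natCast, derivative_one,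
      ← legendreDeriv_succ] at h
    push_cast
    linear_combination h

theorem legendreDeriv_succ_add_two (j l : ℕ) :
    legendreDeriv (j + 1) (l + 2) =
      legendreDeriv (j + 1) l + (2 * (l : ℝ[X]) + 3) * legendreDeriv j (l + 1) := by
  induction j with
  | zero =>
    have h := congrArg derivative (legendreDeriv_zero_add_two_sub l)
    simp only [derivative_add, derivative_mul, derivative_natCast, derivative_ofNat,
      derivative_legendrePrimitive, ← legendreDeriv_succ] at h
    linear_combination h
  | succ j ih =>
    have h := congrArg derivative ih
    simp only [derivative_add, derivative_mul, derivative_natCast, derivative_ofNat,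
      ← legendreDeriv_succ] at h
    linear_combination h

/-- The three-term recurrence for derivatives of Legendre polynomials. -/
theorem legendreDeriv_three_term (m l : ℕ) :
    (2 * (l : ℝ[X]) + 3) * (X * legendreDeriv m (l + 1)) =
      ((l : ℝ[X]) + 2 - (m : ℝ[X])) * legendreDeriv m (l + 2) +
        ((l : ℝ[X]) + 1 + (m : ℝ[X])) * legendreDeriv m l := by
  cases m with
  | zero =>
    push_cast
    linear_combination ((l : ℝ[X]) + 1) * legendreDeriv_zero_add_two_sub l -
      (2 * (l : ℝ[X]) + 3) * legendreDeriv_zero_add_two l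
  | succ j =>
    have h := legendreDeriv_succ_succ j (l + 1)
    push_cast at h ⊢
    linear_combination ((l : ℝ[X]) + 2 + (j : ℝ[X])) * legendreDeriv_succ_add_two j l -
      (2 * (l : ℝ[X]) + 3) * h

theorem legendreDeriv_self_succ (m : ℕ) : legendreDeriv (m + 1) m = 0 := by
  induction m with
  | zero => simp [legendreDeriv_succ, legendreDeriv_zero_zero]
  | succ m ih =>
    have h := legendreDeriv_succ_succ (m + 1) m
    rw [legendreDeriv_succ (m + 1) m, ih] at h
    simpa using h

theorem legendreDeriv_self (m : ℕ) :
    legendreDeriv m m = C ((Nat.factorial (2 * m) : ℝ) / (2 ^ m * Nat.factorial m)) := by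
  induction m with
  | zero => simp [legendreDeriv_zero_zero]
  | succ m ih =>
    have h : (Nat.factorial (2 * (m + 1)) : ℝ) / (2 ^ (m + 1) * Nat.factorial (m + 1)) =
        (m + 1 + m) * (Nat.factorial (2 * m) / (2 ^ m * Nat.factorial m)) := by
      have := Nat.factorial_ne_zero m
      rw [mul_add, mul_one, Nat.factorial_succ, Nat.factorial_succ, Nat.factorial_succ]
      push_cast
      field_simp
      ring
    rw [legendreDeriv_succ_succ, legendreDeriv_self_succ, ih, h]
    simp

/-- Legendre's differential equation, differentiated `m` times. -/
theorem legendreDeriv_ode (m l : ℕ) :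
    (1 - X ^ 2) * legendreDeriv (m + 2) l - 2 * ((m : ℝ[X]) + 1) * X * legendreDeriv (m + 1) l +
      ((l : ℝ[X]) * ((l : ℝ[X]) + 1) - (m : ℝ[X]) * ((m : ℝ[X]) + 1)) * legendreDeriv m l = 0 := by
  induction m with
  | zero =>
    cases l with
    | zero => simp [legendreDeriv_succ, legendreDeriv_zero_zero]
    | succ l =>
      have h1 := legendreDeriv_succ_succ 0 l
      have h3 : legendreDeriv 1 (l + 2) =
        X * legendreDeriv 1 (l + 1) + ((l : ℝ[X]) + 2) * legendreDeriv 0 (l + 1) := by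
        have h := legendreDeriv_succ_succ 0 (l + 1)
        push_cast at h
        linear_combination h
      have h2 := legendreDeriv_succ_add_two 0 l
      have h4 : (1 - X ^ 2) * legendreDeriv 1 (l + 1) =
          ((l : ℝ[X]) + 1) * (legendreDeriv 0 l - X * legendreDeriv 0 (l + 1)) := by
        push_cast at h1
        linear_combination h1 + X * h3 - X * h2
      have h5 := congrArg derivative h4
      simp only [derivative_sub, derivative_add, derivative_mul, derivative_X, derivative_natCast,
        derivative_one, derivative_X_sq, ← legendreDeriv_succ] at h5
      simp only [map_ofNat] at h5
      push_cast
      linear_combination h5 + ((l : ℝ[X]) + 1) * (h3 - h2)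
  | succ m ih =>
    have h := congrArg derivative ih
    simp only [derivative_sub, derivative_add, derivative_mul, derivative_X, derivative_natCast,
      derivative_one, derivative_ofNat, derivative_X_sq, derivative_zero,
      ← legendreDeriv_succ] at h
    simp only [map_ofNat] at h
    push_cast
    linear_combination h

theorem iteratedDeriv_eval (p : ℝ[X]) (n : ℕ) :
    iteratedDeriv n (fun x => p.eval x) = fun x => (derivative^[n] p).eval x := by
  induction n with
  | zero => simp
  | succ n ih =>
    rw [iteratedDeriv_succ, ih]
    funext x
    rw [Polynomial.deriv, Function.iterate_succ_apply']

theorem iteratedDeriv_legendreP (m l : ℕ) (x : ℝ) :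
    iteratedDeriv m (legendreP l) x = (legendreDeriv m l).eval x := by
  have h : legendreP l = fun x => (legendreDeriv 0 l).eval x := by
    funext x
    have := congrFun (iteratedDeriv_eval ((X ^ 2 - 1) ^ l) l) x
    simp only [eval_pow, eval_sub, eval_X, eval_one] at this
    simp [legendreP, this, legendreDeriv, rodriguesCoeff]
  rw [h, iteratedDeriv_eval]
  rfl

end LegendrePolynomials

section AssociatedLegendre

/-- The coefficient `√(l² − m²)`, at `l = m + n`, of the three-term recurrences. -/
noncomputable def offDiag (m n : ℕ) : ℝ := Real.sqrt (((m + n : ℕ) : ℝ) ^ 2 - (m : ℝ) ^ 2)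

theorem offDiag_zero (m : ℕ) : offDiag m 0 = 0 := by simp [offDiag]

theorem offDiag_eq (m n : ℕ) : offDiag m n = Real.sqrt ((n : ℝ) * (2 * m + n)) := by
  rw [offDiag]
  congr 1
  push_cast
  ring

theorem offDiag_sq (m n : ℕ) : offDiag m n ^ 2 = (n : ℝ) * (2 * m + n) := by
  rw [offDiag_eq, Real.sq_sqrt (by positivity)]

theorem offDiag_succ_pos (m n : ℕ) : 0 < offDiag m (n + 1) := by
  rw [offDiag_eq]
  positivity

/-- The normalizing factor `√((l−m)!/(l+m)!)` at `l = m + n`. -/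
noncomputable def pmlScale (m n : ℕ) : ℝ :=
  Real.sqrt ((Nat.factorial n : ℝ) / (Nat.factorial (2 * m + n) : ℝ))

theorem pml_add (m n : ℕ) (x : ℝ) :
    pml m (m + n) x = pmlScale m n * (legendreDeriv m (m + n)).eval x := by
  rw [pml, iteratedDeriv_legendreP, pmlScale, Nat.add_sub_cancel_left,
    show m + n + m = 2 * m + n by ring]

theorem offDiag_mul_pmlScale_succ (m n : ℕ) :
    offDiag m (n + 1) * pmlScale m (n + 1) = ((n : ℝ) + 1) * pmlScale m n := by
  have h := Nat.factorial_ne_zero (2 * m + n)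
  rw [offDiag_eq, pmlScale, pmlScale, ← Real.sqrt_mul (by positivity),
    ← Real.sqrt_sq (show (0 : ℝ) ≤ n + 1 by positivity), ← Real.sqrt_mul (by positivity)]
  congr 1
  rw [← add_assoc, Nat.factorial_succ, Nat.factorial_succ]
  push_cast
  field_simp
  ring

theorem offDiag_mul_pmlScale (m n : ℕ) :
    offDiag m (n + 1) * pmlScale m n = (2 * (m : ℝ) + n + 1) * pmlScale m (n + 1) := by
  have h := Nat.factorial_ne_zero (2 * m + n)
  rw [offDiag_eq, pmlScale, pmlScale, ← Real.sqrt_mul (by positivity),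
    ← Real.sqrt_sq (show (0 : ℝ) ≤ 2 * m + n + 1 by positivity), ← Real.sqrt_mul (by positivity)]
  congr 1
  rw [← add_assoc, Nat.factorial_succ, Nat.factorial_succ]
  push_cast
  field_simp
  ring

theorem legendreDeriv_self_three_term (m : ℕ) :
    (2 * (m : Polynomial ℝ) + 1) * (Polynomial.X * legendreDeriv m m) =
      legendreDeriv m (m + 1) := by
  cases m with
  | zero => simp [legendreDeriv_zero_zero, legendreDeriv_zero_one]
  | succ k =>
    have h := legendreDeriv_three_term (k + 1) k
    rw [legendreDeriv_self_succ] at h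
    push_cast at h ⊢
    linear_combination h

/-- The three-term recurrence for the normalized associated Legendre functions. -/
theorem pml_three_term (m n : ℕ) (x : ℝ) :
    (2 * ((m + n : ℕ) : ℝ) + 1) * (x * pml m (m + n) x) =
      offDiag m (n + 1) * pml m (m + (n + 1)) x + offDiag m n * pml m (m + (n - 1)) x := by
  cases n with
  | zero =>
    have h := congrArg (Polynomial.eval x) (legendreDeriv_self_three_term m)
    have h1 := offDiag_mul_pmlScale_succ m 0
    simp only [Polynomial.eval_mul, Polynomial.eval_add, Polynomial.eval_X, Polynomial.eval_one,
      Polynomial.eval_natCast, Polynomial.eval_ofNat] at h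
    rw [offDiag_zero, pml_add, pml_add]
    push_cast at h1 ⊢
    simp only [zero_add, add_zero] at *
    linear_combination pmlScale m 0 * h - (legendreDeriv m (m + 1)).eval x * h1
  | succ n =>
    have h := congrArg (Polynomial.eval x) (legendreDeriv_three_term m (m + n))
    have h1 := offDiag_mul_pmlScale_succ m (n + 1)
    have h2 := offDiag_mul_pmlScale m n
    simp only [Polynomial.eval_mul, Polynomial.eval_add, Polynomial.eval_sub, Polynomial.eval_X,
      Polynomial.eval_one, Polynomial.eval_natCast, Polynomial.eval_ofNat] at h
    rw [pml_add, pml_add, pml_add]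
    simp only [Nat.add_sub_cancel, ← add_assoc]
    simp only [add_assoc, Nat.reduceAdd] at *
    push_cast at h h1 h2 ⊢
    linear_combination pmlScale m (n + 1) * h - (legendreDeriv m (m + (n + 2))).eval x * h1 -
      (legendreDeriv m (m + n)).eval x * h2

theorem pml_self (m : ℕ) (x : ℝ) :
    pml m m x = Real.sqrt (Nat.factorial (2 * m)) / (2 ^ m * Nat.factorial m) := by
  have h := pml_add m 0 x
  have h0 : (0 : ℝ) < Nat.factorial (2 * m) := by positivity
  rw [add_zero, legendreDeriv_self, Polynomial.eval_C, pmlScale, add_zero, Nat.factorial_zero,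
    Nat.cast_one, one_div, Real.sqrt_inv] at h
  rw [h, ← mul_div_assoc]
  congr 1
  rw [inv_mul_eq_div, Real.div_sqrt]

theorem pml_self_pos (m : ℕ) (x : ℝ) : 0 < pml m m x := by
  rw [pml_self]
  positivity

@[fun_prop]
theorem continuous_pml (m l : ℕ) : Continuous (pml m l) := by
  unfold pml
  simp only [iteratedDeriv_legendreP]
  fun_prop

theorem offDiag_mul_abs_pml_succ_ge (m n : ℕ) {x : ℝ} (hx : 1 ≤ |x|) :
    (2 * (m : ℝ) + n + 1) * |pml m (m + n) x| ≤ offDiag m (n + 1) * |pml m (m + (n + 1)) x| := by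
  have key : ∀ k : ℕ, (2 * ((m + k : ℕ) : ℝ) + 1) * |pml m (m + k) x| ≤
      offDiag m (k + 1) * |pml m (m + (k + 1)) x| + offDiag m k * |pml m (m + (k - 1)) x| := by
    intro k
    have h0 : 0 ≤ offDiag m k := Real.sqrt_nonneg _
    calc (2 * ((m + k : ℕ) : ℝ) + 1) * |pml m (m + k) x|
        ≤ (2 * ((m + k : ℕ) : ℝ) + 1) * (|x| * |pml m (m + k) x|) := by
          gcongr
          exact le_mul_of_one_le_left (abs_nonneg _) hx
      _ = |(2 * ((m + k : ℕ) : ℝ) + 1) * (x * pml m (m + k) x)| := by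
          rw [abs_mul, abs_mul, abs_of_nonneg (show 0 ≤ 2 * ((m + k : ℕ) : ℝ) + 1 by positivity)]
      _ ≤ _ := by
          rw [pml_three_term]
          refine (abs_add_le _ _).trans ?_
          rw [abs_mul, abs_mul, abs_of_nonneg h0, abs_of_pos (offDiag_succ_pos m k)]
  induction n with
  | zero =>
    have h := key 0
    rw [offDiag_zero] at h
    push_cast at h ⊢
    simp only [add_zero, zero_mul] at *
    exact h
  | succ n ih =>
    have h := key (n + 1)
    have hsq := offDiag_sq m (n + 1)
    have hpos := offDiag_succ_pos m n
    rw [Nat.add_sub_cancel] at h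
    have h2 : offDiag m (n + 1) * |pml m (m + n) x| ≤ ((n : ℝ) + 1) * |pml m (m + (n + 1)) x| := by
      have hc : (0 : ℝ) < 2 * m + n + 1 := by positivity
      refine le_of_mul_le_mul_left ?_ hc
      push_cast at hsq
      calc (2 * (m : ℝ) + n + 1) * (offDiag m (n + 1) * |pml m (m + n) x|)
          = offDiag m (n + 1) * ((2 * (m : ℝ) + n + 1) * |pml m (m + n) x|) := by ring
        _ ≤ offDiag m (n + 1) * (offDiag m (n + 1) * |pml m (m + (n + 1)) x|) := by gcongr
        _ = offDiag m (n + 1) ^ 2 * |pml m (m + (n + 1)) x| := by ring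
        _ = _ := by rw [hsq]; ring
    push_cast at h ⊢
    linarith

theorem abs_pml_ge (m n : ℕ) {x : ℝ} (hx : 1 ≤ |x|) : pml m m x ≤ |pml m (m + n) x| := by
  induction n with
  | zero => exact le_abs_self _
  | succ n ih =>
    refine ih.trans ?_
    have h := offDiag_mul_abs_pml_succ_ge m n hx
    have hle : offDiag m (n + 1) ≤ 2 * (m : ℝ) + n + 1 := by
      refine Real.sqrt_le_iff.2 ⟨by positivity, ?_⟩
      push_cast
      nlinarith [sq_nonneg (m : ℝ), (Nat.cast_nonneg m : (0 : ℝ) ≤ m),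
        (Nat.cast_nonneg n : (0 : ℝ) ≤ n), mul_nonneg (Nat.cast_nonneg m : (0 : ℝ) ≤ m)
          (Nat.cast_nonneg n : (0 : ℝ) ≤ n)]
    have hc : (0 : ℝ) < 2 * m + n + 1 := by positivity
    exact le_of_mul_le_mul_left (h.trans (by gcongr)) hc

theorem pml_ne_zero (m n : ℕ) {x : ℝ} (hx : 1 ≤ |x|) : pml m (m + n) x ≠ 0 :=
  abs_pos.1 ((pml_self_pos m x).trans_le (abs_pml_ge m n hx))

end AssociatedLegendre

section Orthogonality

open Polynomial in
theorem integral_eval_derivative (p : ℝ[X]) :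
    ∫ x in (-1 : ℝ)..1, (derivative p).eval x = p.eval 1 - p.eval (-1) :=
  intervalIntegral.integral_eq_sub_of_hasDerivAt (fun x _ => p.hasDerivAt x)
    ((derivative p).continuous.intervalIntegrable _ _)

open Polynomial in
theorem integral_legendreDeriv_mul {m l k : ℕ} (hlk : l ≠ k) :
    ∫ x in (-1 : ℝ)..1,
      (legendreDeriv m l).eval x * (legendreDeriv m k).eval x * (1 - x ^ 2) ^ m = 0 := by
  have hF : derivative ((1 - X ^ 2) ^ (m + 1) * (legendreDeriv (m + 1) l * legendreDeriv m k -
        legendreDeriv m l * legendreDeriv (m + 1) k)) =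
      C ((k : ℝ) * (k + 1) - l * (l + 1)) *
        (legendreDeriv m l * legendreDeriv m k * (1 - X ^ 2) ^ m) := by
    have hl := legendreDeriv_ode m l
    have hk := legendreDeriv_ode m k
    simp only [derivative_mul, derivative_pow, derivative_one, derivative_X,
      ← legendreDeriv_succ, map_sub, map_mul, map_add, map_natCast, map_one, Nat.add_sub_cancel]
    push_cast
    linear_combination (1 - X ^ 2) ^ m * (legendreDeriv m k * hl - legendreDeriv m l * hk)
  have h := integral_eval_derivative ((1 - X ^ 2) ^ (m + 1) *
    (legendreDeriv (m + 1) l * legendreDeriv m k - legendreDeriv m l * legendreDeriv (m + 1) k))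
  rw [hF] at h
  simp only [eval_mul, eval_C, eval_pow, eval_sub, eval_one, eval_X,
    intervalIntegral.integral_const_mul] at h
  norm_num at h
  refine h.resolve_left fun h0 => hlk ?_
  have h1 : ((k : ℝ) - l) * (k + l + 1) = 0 := by linear_combination h0
  have h2 : (k : ℝ) - l = 0 := (mul_eq_zero.1 h1).resolve_right (by positivity)
  exact_mod_cast (sub_eq_zero.1 h2).symm

theorem integral_pml_mul_pml_of_ne {m n k : ℕ} (h : n ≠ k) :
    ∫ x in (-1 : ℝ)..1, pml m (m + n) x * pml m (m + k) x * (1 - x ^ 2) ^ m = 0 := by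
  have h0 := integral_legendreDeriv_mul (m := m) (l := m + n) (k := m + k) (by omega)
  rw [← mul_zero (pmlScale m n * pmlScale m k), ← h0, ← intervalIntegral.integral_const_mul]
  congr 1
  funext x
  rw [pml_add, pml_add]
  ring

theorem integral_one_sub_sq_pow_succ (m : ℕ) :
    (2 * (m : ℝ) + 3) * ∫ x in (-1 : ℝ)..1, (1 - x ^ 2) ^ (m + 1) =
      (2 * (m : ℝ) + 2) * ∫ x in (-1 : ℝ)..1, (1 - x ^ 2) ^ m := by
  have h : ∫ x in (-1 : ℝ)..1, ((2 * (m : ℝ) + 3) * (1 - x ^ 2) ^ (m + 1) -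
      (2 * (m : ℝ) + 2) * (1 - x ^ 2) ^ m) = 0 := by
    have hd : ∀ x : ℝ, HasDerivAt (fun y : ℝ => y * (1 - y ^ 2) ^ (m + 1))
        ((2 * (m : ℝ) + 3) * (1 - x ^ 2) ^ (m + 1) - (2 * (m : ℝ) + 2) * (1 - x ^ 2) ^ m) x := by
      intro x
      have h1 : HasDerivAt (fun y : ℝ => y * (1 - y ^ 2) ^ (m + 1)) _ x :=
        (hasDerivAt_id' x).mul ((((hasDerivAt_id' x).fun_pow 2).const_sub 1).fun_pow (m + 1))
      refine h1.congr_deriv ?_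
      push_cast
      ring_nf
    rw [intervalIntegral.integral_eq_sub_of_hasDerivAt (fun x _ => hd x)
      (Continuous.intervalIntegrable (by fun_prop) _ _)]
    simp
  rw [intervalIntegral.integral_sub (Continuous.intervalIntegrable (by fun_prop) _ _)
    (Continuous.intervalIntegrable (by fun_prop) _ _), intervalIntegral.integral_const_mul,
    intervalIntegral.integral_const_mul] at h
  linarith

theorem integral_one_sub_sq_pow (m : ℕ) :
    ∫ x in (-1 : ℝ)..1, (1 - x ^ 2) ^ m =
      2 * (2 ^ m * Nat.factorial m) ^ 2 / ((2 * (m : ℝ) + 1) * Nat.factorial (2 * m)) := by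
  induction m with
  | zero => norm_num
  | succ m ih =>
    have h := integral_one_sub_sq_pow_succ m
    have hm := Nat.factorial_ne_zero m
    have hm2 := Nat.factorial_ne_zero (2 * m)
    rw [ih] at h
    have h3 : (2 * (m : ℝ) + 3) ≠ 0 := by positivity
    refine mul_left_cancel₀ h3 (h.trans ?_)
    rw [mul_add, mul_one, Nat.factorial_succ, Nat.factorial_succ, Nat.factorial_succ]
    push_cast
    field_simp
    ring

/-- The squared norm of the normalized associated Legendre functions. -/
theorem integral_pml_sq (m n : ℕ) :
    ∫ x in (-1 : ℝ)..1, pml m (m + n) x * pml m (m + n) x * (1 - x ^ 2) ^ m =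
      2 / (2 * ((m + n : ℕ) : ℝ) + 1) := by
  induction n with
  | zero =>
    have hm := Nat.factorial_ne_zero m
    have hs := Real.sq_sqrt (show (0 : ℝ) ≤ Nat.factorial (2 * m) by positivity)
    have hs0 : (Nat.factorial (2 * m) : ℝ) ≠ 0 := by positivity
    simp only [add_zero, pml_self, intervalIntegral.integral_const_mul, integral_one_sub_sq_pow]
    rw [← sq, div_pow, hs]
    field_simp
  | succ n ih =>
    have expand : ∀ j k : ℕ,
        (2 * ((m + j : ℕ) : ℝ) + 1) *
          ∫ x in (-1 : ℝ)..1, x * pml m (m + j) x * pml m (m + k) x * (1 - x ^ 2) ^ m =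
        offDiag m (j + 1) *
          (∫ x in (-1 : ℝ)..1, pml m (m + (j + 1)) x * pml m (m + k) x * (1 - x ^ 2) ^ m) +
        offDiag m j *
          ∫ x in (-1 : ℝ)..1, pml m (m + (j - 1)) x * pml m (m + k) x * (1 - x ^ 2) ^ m := by
      intro j k
      simp only [← intervalIntegral.integral_const_mul]
      rw [← intervalIntegral.integral_add (Continuous.intervalIntegrable (by fun_prop) _ _)
        (Continuous.intervalIntegrable (by fun_prop) _ _)]
      congr 1
      funext x
      linear_combination (pml m (m + k) x * (1 - x ^ 2) ^ m) * pml_three_term m j x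
    have h1 := expand n (n + 1)
    have h2 := expand (n + 1) n
    rw [integral_pml_mul_pml_of_ne (by omega : n - 1 ≠ n + 1)] at h1
    rw [integral_pml_mul_pml_of_ne (by omega : n + 1 + 1 ≠ n), Nat.add_sub_cancel, ih] at h2
    have hswap : ∫ x in (-1 : ℝ)..1, x * pml m (m + (n + 1)) x * pml m (m + n) x * (1 - x ^ 2) ^ m
        = ∫ x in (-1 : ℝ)..1, x * pml m (m + n) x * pml m (m + (n + 1)) x * (1 - x ^ 2) ^ m := by
      congr 1
      funext x
      ring
    rw [hswap] at h2
    have ha := (offDiag_succ_pos m n).ne'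
    have hc1 : (2 * ((m + n : ℕ) : ℝ) + 1) ≠ 0 := by positivity
    have hc2 : (2 * ((m + (n + 1) : ℕ) : ℝ) + 1) ≠ 0 := by positivity
    rw [eq_div_iff hc2]
    refine mul_left_cancel₀ ha ?_
    rw [mul_div_assoc', mul_zero, zero_add, eq_div_iff hc1] at h2
    linear_combination h2 - (2 * ((m + (n + 1) : ℕ) : ℝ) + 1) * h1

theorem integral_pml_weight (m n : ℕ) (w : ℝ) :
    pml m m w * ((2 * ((m + n : ℕ) : ℝ) + 1) *
      (1 / 2 * ∫ x in (-1 : ℝ)..1, pml m (m + n) x * (1 - x ^ 2) ^ m)) =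
      if n = 0 then 1 else 0 := by
  have h : ∫ x in (-1 : ℝ)..1, pml m (m + n) x * pml m (m + 0) x * (1 - x ^ 2) ^ m =
      pml m m w * ∫ x in (-1 : ℝ)..1, pml m (m + n) x * (1 - x ^ 2) ^ m := by
    rw [← intervalIntegral.integral_const_mul]
    congr 1
    funext x
    rw [add_zero, pml_self m x, pml_self m w]
    ring
  split_ifs with hn
  · subst hn
    rw [integral_pml_sq] at h
    have hc : (2 * ((m + 0 : ℕ) : ℝ) + 1) ≠ 0 := by positivity
    rw [div_eq_iff hc] at h
    linear_combination -(1 / 2) * h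
  · rw [integral_pml_mul_pml_of_ne hn] at h
    linear_combination -(1 / 2) * (2 * ((m + n : ℕ) : ℝ) + 1) * h

end Orthogonality

section SecondKind

theorem sub_ne_zero_of_one_lt_abs {w x : ℝ} (hw : 1 < |w|) (hx : x ∈ Set.uIcc (-1 : ℝ) 1) :
    w - x ≠ 0 := by
  rw [Set.uIcc_of_le (by norm_num)] at hx
  rintro h
  rw [sub_eq_zero.1 h] at hw
  exact hw.not_ge (abs_le.2 hx)

theorem intervalIntegrable_div_sub {f : ℝ → ℝ} (hf : Continuous f) (m : ℕ) {w : ℝ}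
    (hw : 1 < |w|) :
    IntervalIntegrable (fun x => f x / (w - x) * (1 - x ^ 2) ^ m) volume (-1) 1 := by
  refine ContinuousOn.intervalIntegrable ?_
  refine ContinuousOn.mul (hf.continuousOn.div (by fun_prop) fun x hx => ?_) (by fun_prop)
  exact sub_ne_zero_of_one_lt_abs hw hx

/-- The inhomogeneous three-term recurrence for the functions of the second kind. -/
theorem qml_three_term (m n : ℕ) {w : ℝ} (hw : 1 < |w|) :
    (2 * ((m + n : ℕ) : ℝ) + 1) * (w * qml m (m + n) w) =
      offDiag m (n + 1) * qml m (m + (n + 1)) w + offDiag m n * qml m (m + (n - 1)) w +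
        (2 * ((m + n : ℕ) : ℝ) + 1) *
          (1 / 2 * ∫ x in (-1 : ℝ)..1, pml m (m + n) x * (1 - x ^ 2) ^ m) := by
  have hi := fun k => intervalIntegrable_div_sub (continuous_pml m k) m hw
  have h : (2 * ((m + n : ℕ) : ℝ) + 1) * (w *
      ∫ x in (-1 : ℝ)..1, pml m (m + n) x / (w - x) * (1 - x ^ 2) ^ m) =
      offDiag m (n + 1) *
        (∫ x in (-1 : ℝ)..1, pml m (m + (n + 1)) x / (w - x) * (1 - x ^ 2) ^ m) +
      offDiag m n *
        (∫ x in (-1 : ℝ)..1, pml m (m + (n - 1)) x / (w - x) * (1 - x ^ 2) ^ m) +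
      (2 * ((m + n : ℕ) : ℝ) + 1) *
        ∫ x in (-1 : ℝ)..1, pml m (m + n) x * (1 - x ^ 2) ^ m := by
    simp only [← intervalIntegral.integral_const_mul]
    rw [← intervalIntegral.integral_add ((hi _).const_mul _) ((hi _).const_mul _),
      ← intervalIntegral.integral_add (((hi _).const_mul _).add ((hi _).const_mul _))
        (Continuous.intervalIntegrable (by fun_prop) _ _)]
    refine intervalIntegral.integral_congr fun x hx => ?_
    have h0 := sub_ne_zero_of_one_lt_abs hw hx
    have h1 := pml_three_term m n x
    field_simp
    linear_combination (1 - x ^ 2) ^ m * h1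
  simp only [qml]
  linear_combination (1 / 2) * h

theorem abs_qml_le (m n : ℕ) {w : ℝ} (hw : 1 < |w|) :
    |qml m (m + n) w| ≤ 1 / ((|w| - 1) * Real.sqrt (2 * ((m + n : ℕ) : ℝ) + 1)) := by
  set s := Real.sqrt (2 * ((m + n : ℕ) : ℝ) + 1) with hs
  have hs0 : 0 < s := Real.sqrt_pos.2 (by positivity)
  have hs2 : s ^ 2 = 2 * ((m + n : ℕ) : ℝ) + 1 := Real.sq_sqrt (by positivity)
  have hδ : 0 < |w| - 1 := by linarith
  have hI : ∫ x in (-1 : ℝ)..1, (1 / (2 * (|w| - 1))) *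
      (s * (pml m (m + n) x * pml m (m + n) x * (1 - x ^ 2) ^ m) + 1 / s) =
      2 / ((|w| - 1) * s) := by
    rw [intervalIntegral.integral_const_mul,
      intervalIntegral.integral_add (Continuous.intervalIntegrable (by fun_prop) _ _)
        (Continuous.intervalIntegrable (by fun_prop) _ _),
      intervalIntegral.integral_const_mul, integral_pml_sq, ← hs2,
      intervalIntegral.integral_const]
    simp only [smul_eq_mul]
    field_simp
    norm_num
  have hbound := intervalIntegral.norm_integral_le_of_norm_le (μ := volume)
    (f := fun x => pml m (m + n) x / (w - x) * (1 - x ^ 2) ^ m)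
    (g := fun x => (1 / (2 * (|w| - 1))) *
      (s * (pml m (m + n) x * pml m (m + n) x * (1 - x ^ 2) ^ m) + 1 / s))
    (show (-1 : ℝ) ≤ 1 by norm_num) (Eventually.of_forall fun x hx => by
      have hx1 : |x| ≤ 1 := abs_le.2 ⟨hx.1.le, hx.2⟩
      have hd : |w| - 1 ≤ |w - x| := by
        linarith [abs_sub_abs_le_abs_sub w x]
      have hx2 : x ^ 2 ≤ 1 := (sq_le_one_iff_abs_le_one x).2 hx1
      have hq0 : 0 ≤ (1 - x ^ 2) ^ m := pow_nonneg (by linarith) m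
      have hq1 : (1 - x ^ 2) ^ m ≤ 1 := pow_le_one₀ (by linarith) (by nlinarith [sq_nonneg x])
      rw [Real.norm_eq_abs, abs_mul, abs_div, abs_of_nonneg hq0]
      have hamgm : 2 * |pml m (m + n) x| ≤ s * (pml m (m + n) x * pml m (m + n) x) + 1 / s := by
        rw [← abs_mul_abs_self (pml m (m + n) x)]
        have h1 := sq_nonneg (s * |pml m (m + n) x| - 1)
        have h2 : s * |pml m (m + n) x| ^ 2 + 1 / s - 2 * |pml m (m + n) x| =
            (s * |pml m (m + n) x| - 1) ^ 2 / s := by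
          field_simp
          ring
        have h3 : 0 ≤ (s * |pml m (m + n) x| - 1) ^ 2 / s := by positivity
        linarith
      have hs1 : 0 < 1 / s := by positivity
      calc |pml m (m + n) x| / |w - x| * (1 - x ^ 2) ^ m
          ≤ |pml m (m + n) x| / (|w| - 1) * (1 - x ^ 2) ^ m := by gcongr
        _ = (1 / (2 * (|w| - 1))) * (2 * |pml m (m + n) x| * (1 - x ^ 2) ^ m) := by
          field_simp
        _ ≤ (1 / (2 * (|w| - 1))) *
            ((s * (pml m (m + n) x * pml m (m + n) x) + 1 / s) * (1 - x ^ 2) ^ m) := by gcongr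
        _ ≤ _ := by
          gcongr
          nlinarith)
    (Continuous.intervalIntegrable (by fun_prop) _ _)
  rw [hI, Real.norm_eq_abs] at hbound
  rw [qml, abs_mul, abs_of_pos (by norm_num : (0 : ℝ) < 1 / 2)]
  calc _ ≤ 1 / 2 * (2 / ((|w| - 1) * s)) := by gcongr
    _ = _ := by ring

theorem tendsto_qml_zero (m : ℕ) {w : ℝ} (hw : 1 < |w|) :
    Tendsto (fun n => qml m (m + n) w) atTop (nhds 0) := by
  refine squeeze_zero_norm (fun n => abs_qml_le m n hw) ?_
  refine Tendsto.div_atTop tendsto_const_nhds (Tendsto.const_mul_atTop (by linarith) ?_)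
  refine Real.tendsto_sqrt_atTop.comp (tendsto_atTop_mono (fun n => ?_) tendsto_natCast_atTop_atTop)
  push_cast
  linarith [(Nat.cast_nonneg m : (0 : ℝ) ≤ m), (Nat.cast_nonneg n : (0 : ℝ) ≤ n)]

theorem tendsto_qml_div_pml_zero (m : ℕ) {w : ℝ} (hw : 1 < |w|) :
    Tendsto (fun n => qml m (m + n) w / pml m (m + n) w) atTop (nhds 0) := by
  have h := (tendsto_qml_zero m hw).abs.div_const (pml m m w)
  rw [abs_zero, zero_div] at h
  refine squeeze_zero_norm (fun n => ?_) h
  rw [Real.norm_eq_abs, abs_div]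
  gcongr
  · exact pml_self_pos m w
  · exact abs_pml_ge m n hw.le

end SecondKind

section Casoratian

/-- If `p` and `g` satisfy three-term recurrences that differ by the perturbation `e`, and `q`
satisfies the recurrence of `p` with a unit source at `0`, then `g` is obtained from `p` and `q`
by variation of constants. -/
theorem eq_of_perturbed_recurrence {a c e p q g : ℕ → ℝ} {x d : ℝ} (ha0 : a 0 = 0)
    (hp : ∀ n, c n * (x * p n) = a (n + 1) * p (n + 1) + a n * p (n - 1))
    (hq : ∀ n, c n * (x * q n) =
      a (n + 1) * q (n + 1) + a n * q (n - 1) + if n = 0 then d else 0)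
    (hg : ∀ n, (c n - e n) * (x * g n) = a (n + 1) * g (n + 1) + a n * g (n - 1))
    (hpd : p 0 * d = 1) (hgp : g 0 = p 0) (n : ℕ) :
    g n = p n * (1 - x * ∑ k ∈ Finset.range (n + 1), e k * g k * q k) +
      q n * (x * ∑ k ∈ Finset.range (n + 1), e k * g k * p k) := by
  have hW : ∀ n, a (n + 1) * (p (n + 1) * q n - p n * q (n + 1)) = 1 := by
    intro n
    induction n with
    | zero =>
      have h1 := hp 0
      have h2 := hq 0
      rw [ha0] at h1 h2
      rw [if_pos rfl] at h2
      linear_combination hpd - q 0 * h1 + p 0 * h2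
    | succ n ih =>
      have h1 := hp (n + 1)
      have h2 := hq (n + 1)
      rw [if_neg n.succ_ne_zero] at h2
      simp only [Nat.add_sub_cancel] at h1 h2
      linear_combination ih - q (n + 1) * h1 + p (n + 1) * h2
  have hV : ∀ n, a (n + 1) * (p (n + 1) * g n - p n * g (n + 1)) =
      x * ∑ k ∈ Finset.range (n + 1), e k * g k * p k := by
    intro n
    induction n with
    | zero =>
      have h1 := hp 0
      have h2 := hg 0
      rw [ha0] at h1 h2
      simp only [zero_add, Finset.sum_range_one] at *
      linear_combination p 0 * h2 - g 0 * h1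
    | succ n ih =>
      have h1 := hp (n + 1)
      have h2 := hg (n + 1)
      rw [Finset.sum_range_succ]
      simp only [Nat.add_sub_cancel] at h1 h2
      linear_combination ih + p (n + 1) * h2 - g (n + 1) * h1
  have hU : ∀ n, a (n + 1) * (q (n + 1) * g n - q n * g (n + 1)) =
      x * ∑ k ∈ Finset.range (n + 1), e k * g k * q k - 1 := by
    intro n
    induction n with
    | zero =>
      have h1 := hq 0
      have h2 := hg 0
      rw [ha0] at h1 h2
      rw [if_pos rfl] at h1
      simp only [zero_add, Finset.sum_range_one] at *
      linear_combination q 0 * h2 - g 0 * h1 - hpd - d * hgp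
    | succ n ih =>
      have h1 := hq (n + 1)
      have h2 := hg (n + 1)
      rw [if_neg n.succ_ne_zero] at h1
      rw [Finset.sum_range_succ]
      simp only [Nat.add_sub_cancel] at h1 h2
      linear_combination ih + q (n + 1) * h2 - g (n + 1) * h1
  linear_combination q n * hV n - p n * hU n - g n * hW n

end Casoratian

section Chandrasekhar

/-- The deviation `2l + 1 − h_l`, at `l = m + n`. -/
noncomputable def hDefect (ϖ : ℝ) (β : ℕ → ℝ) (L m n : ℕ) : ℝ :=
  if m + n ≤ L then ϖ * β (m + n) else 0

theorem hcoef_add (ϖ : ℝ) (β : ℕ → ℝ) (L m n : ℕ) :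
    hcoef ϖ β L (m + n) = 2 * ((m + n : ℕ) : ℝ) + 1 - hDefect ϖ β L m n := by
  unfold hcoef hDefect
  split_ifs <;> ring

theorem gml_add (ϖ : ℝ) (β : ℕ → ℝ) (L m n : ℕ) (ν : ℝ) :
    gml ϖ β L m (m + n) ν = chandraAux ϖ β L m ν n := by
  simp [gml]

theorem gml_three_term (ϖ : ℝ) (β : ℕ → ℝ) (L m n : ℕ) (ν : ℝ) :
    (2 * ((m + n : ℕ) : ℝ) + 1 - hDefect ϖ β L m n) * (ν * gml ϖ β L m (m + n) ν) =
      offDiag m (n + 1) * gml ϖ β L m (m + (n + 1)) ν +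
        offDiag m n * gml ϖ β L m (m + (n - 1)) ν := by
  have ha := (offDiag_succ_pos m n).ne'
  rw [← hcoef_add]
  simp only [gml_add]
  cases n with
  | zero =>
    rw [offDiag_zero]
    have h : offDiag m (0 + 1) = Real.sqrt (((m : ℝ) + 1) ^ 2 - (m : ℝ) ^ 2) := by simp [offDiag]
    rw [h] at ha ⊢
    simp only [chandraAux, add_zero]
    field_simp
    ring
  | succ n =>
    have h : chandraAux ϖ β L m ν (n + 2) =
      (ν * hcoef ϖ β L (m + (n + 1)) * chandraAux ϖ β L m ν (n + 1) -
        offDiag m (n + 1) * chandraAux ϖ β L m ν n) / offDiag m (n + 1 + 1) := rfl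
    rw [h, Nat.add_sub_cancel]
    field_simp
    ring

theorem Lam_eq (ϖ : ℝ) (β : ℕ → ℝ) {L m : ℕ} (hm : m ≤ L) {w : ℝ} (hw : 1 < |w|) :
    Lam ϖ β L m w = 1 - w * ∑ k ∈ Finset.range (L - m + 1),
      hDefect ϖ β L m k * gml ϖ β L m (m + k) w * qml m (m + k) w := by
  have hi := fun k => (intervalIntegrable_div_sub (continuous_pml m k) m hw).const_mul
    (β k * gml ϖ β L m k w)
  have h : ∫ μ in (-1 : ℝ)..1, gfun ϖ β L m w μ / (w - μ) * (1 - μ ^ 2) ^ m =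
      ∑ k ∈ Finset.Icc m L, β k * gml ϖ β L m k w *
        ∫ μ in (-1 : ℝ)..1, pml m k μ / (w - μ) * (1 - μ ^ 2) ^ m := by
    simp only [← intervalIntegral.integral_const_mul]
    rw [← intervalIntegral.integral_finsetSum fun k _ => hi k]
    congr 1
    funext μ
    rw [gfun, Finset.sum_div, Finset.sum_mul]
    exact Finset.sum_congr rfl fun k _ => by ring
  rw [Lam, h, ← Finset.Ico_succ_right_eq_Icc, Finset.sum_Ico_eq_sum_range, Finset.mul_sum,
    Finset.mul_sum, Order.succ_eq_add_one, show L + 1 - m = L - m + 1 by omega]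
  congr 1
  refine Finset.sum_congr rfl fun k hk => ?_
  rw [hDefect, if_pos (by have := Finset.mem_range.1 hk; omega), qml]
  ring

theorem sum_hDefect_eq (ϖ : ℝ) (β : ℕ → ℝ) (L m : ℕ) (f : ℕ → ℝ) {n : ℕ} (hn : L - m ≤ n) :
    ∑ k ∈ Finset.range (n + 1), hDefect ϖ β L m k * f k =
      ∑ k ∈ Finset.range (L - m + 1), hDefect ϖ β L m k * f k := by
  refine (Finset.sum_subset (Finset.range_mono (by omega)) fun k _ hk => ?_).symm
  rw [Finset.mem_range] at hk
  rw [hDefect, if_neg (by omega), zero_mul]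

theorem gml_div_pml_eq (ϖ : ℝ) (β : ℕ → ℝ) {L m : ℕ} (hm : m ≤ L) {w : ℝ} (hw : 1 < |w|)
    {n : ℕ} (hn : L - m ≤ n) :
    gml ϖ β L m (m + n) w / pml m (m + n) w = Lam ϖ β L m w +
      w * (∑ k ∈ Finset.range (L - m + 1),
        hDefect ϖ β L m k * (gml ϖ β L m (m + k) w * pml m (m + k) w)) *
        (qml m (m + n) w / pml m (m + n) w) := by
  have h := eq_of_perturbed_recurrence (a := offDiag m) (c := fun n => 2 * ((m + n : ℕ) : ℝ) + 1)
    (e := hDefect ϖ β L m) (p := fun n => pml m (m + n) w) (q := fun n => qml m (m + n) w)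
    (g := fun n => gml ϖ β L m (m + n) w) (x := w) (d := 1 / pml m m w) (offDiag_zero m)
    (fun n => pml_three_term m n w)
    (fun n => by
      have hp := (pml_self_pos m w).ne'
      have h1 := integral_pml_weight m n w
      rw [qml_three_term m n hw, add_right_inj]
      refine mul_left_cancel₀ hp (h1.trans ?_)
      split_ifs <;> simp [hp])
    (fun n => gml_three_term ϖ β L m n w)
    (mul_one_div_cancel (pml_self_pos m w).ne')
    ((gml_add ϖ β L m 0 w).trans (pml_self m w).symm) n
  simp only [mul_assoc] at h
  rw [sum_hDefect_eq ϖ β L m _ hn, sum_hDefect_eq ϖ β L m _ hn] at h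
  rw [Lam_eq ϖ β hm hw, h]
  have hp := pml_ne_zero m n hw.le
  simp only [mul_assoc]
  field_simp

end Chandrasekhar

/-- for every real `ν` with `|ν| > 1`, `p_l^m(ν) ≠ 0` for every `l ≥ m`
and `g_l^m(ν)/p_l^m(ν) → Λ^m(ν)` as `l → ∞`. -/
theorem stmt_0 (L : ℕ) (hL : 1 ≤ L) (ϖ : ℝ) (hϖ : ϖ ∈ Set.Ioo (0 : ℝ) 1)
    (β : ℕ → ℝ) (hβ0 : β 0 = 1)
    (hβ : ∀ l : ℕ, 1 ≤ l → l ≤ L → β l ∈ Set.Ioo (0 : ℝ) (2 * (l : ℝ) + 1))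
    (m : ℕ) (hm : m ≤ L)
    (ν : ℝ) (hν : 1 < |ν|) :
    (∀ l : ℕ, m ≤ l → pml m l ν ≠ 0) ∧
      Tendsto (fun l : ℕ => gml ϖ β L m l ν / pml m l ν) atTop (nhds (Lam ϖ β L m ν)) := by
  refine ⟨fun l hl => ?_, ?_⟩
  · obtain ⟨n, rfl⟩ := Nat.exists_eq_add_of_le hl
    exact pml_ne_zero m n hν.le
  · rw [← tendsto_add_atTop_iff_nat m]
    have h := ((tendsto_qml_div_pml_zero m hν).const_mul
      (ν * ∑ k ∈ Finset.range (L - m + 1),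
        hDefect ϖ β L m k * (gml ϖ β L m (m + k) ν * pml m (m + k) ν))).const_add (Lam ϖ β L m ν)
    rw [mul_zero, add_zero] at h
    refine h.congr' ?_
    filter_upwards [eventually_ge_atTop (L - m)] with n hn
    rw [add_comm n m, gml_div_pml_eq ϖ β hm hν hn]
end

section
/- If a real number ν satisfies g_{l_B+1}^m(ν) = 0, then the vector v indexed by l ∈ {m, …, l_B} with components v_l = √(h_l) g_l^m(ν) is nonzero and satisfies B(m) v = ν v; in particular, ν is an eigenvalue of the matrix B(m). -/
open MeasureTheory Filter

lemma hcoef_pos {L : ℕ} {ϖ : ℝ} (hϖ : ϖ ∈ Set.Ioo (0 : ℝ) 1) {β : ℕ → ℝ} (hβ0 : β 0 = 1)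
    (hβ : ∀ l : ℕ, 1 ≤ l → l ≤ L → β l ∈ Set.Ioo (0 : ℝ) (2 * (l : ℝ) + 1)) (l : ℕ) :
    0 < hcoef ϖ β L l := by
  obtain ⟨hϖ0, hϖ1⟩ := hϖ
  unfold hcoef
  split_ifs with hl
  · rcases Nat.eq_zero_or_pos l with rfl | hpos
    · simp [hβ0, hϖ1]
    · obtain ⟨h0, h1⟩ := hβ l hpos hl
      nlinarith
  · positivity

lemma sqrt_succ_sq_sub_sq_pos (m n : ℕ) :
    0 < Real.sqrt (((m + (n + 1) : ℕ) : ℝ) ^ 2 - (m : ℝ) ^ 2) := by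
  apply Real.sqrt_pos.mpr
  have hm : (0 : ℝ) ≤ m := m.cast_nonneg
  have hn : (0 : ℝ) ≤ n := n.cast_nonneg
  push_cast
  nlinarith [mul_nonneg hm hn]

/-- The three-term recurrence; at `n = 0` the last coefficient vanishes. -/
lemma chandraAux_recurrence (ϖ : ℝ) (β : ℕ → ℝ) (L m : ℕ) (ν : ℝ) (n : ℕ) :
    ν * hcoef ϖ β L (m + n) * chandraAux ϖ β L m ν n =
      Real.sqrt (((m + (n + 1) : ℕ) : ℝ) ^ 2 - (m : ℝ) ^ 2) * chandraAux ϖ β L m ν (n + 1) +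
        Real.sqrt (((m + n : ℕ) : ℝ) ^ 2 - (m : ℝ) ^ 2) * chandraAux ϖ β L m ν (n - 1) := by
  have hpos := (sqrt_succ_sq_sub_sq_pos m n).ne'
  cases n with
  | zero =>
    simp only [zero_add, Nat.cast_add, Nat.cast_one] at hpos
    simp only [chandraAux, zero_add, add_zero, sub_self, Real.sqrt_zero, zero_mul,
      Nat.cast_add, Nat.cast_one]
    rw [mul_div_cancel₀ _ hpos]
  | succ k =>
    have hrec : chandraAux ϖ β L m ν (k + 1 + 1) =
        (ν * hcoef ϖ β L (m + (k + 1)) * chandraAux ϖ β L m ν (k + 1) -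
          Real.sqrt (((m + (k + 1) : ℕ) : ℝ) ^ 2 - (m : ℝ) ^ 2) * chandraAux ϖ β L m ν k) /
        Real.sqrt (((m + (k + 1 + 1) : ℕ) : ℝ) ^ 2 - (m : ℝ) ^ 2) := by
      rw [chandraAux]; rfl
    rw [hrec, mul_div_cancel₀ _ hpos]
    simp

lemma bcoef_succ {ϖ : ℝ} {β : ℕ → ℝ} {L : ℕ} (hpos : ∀ l, 0 < hcoef ϖ β L l) (m n : ℕ) :
    bcoef ϖ β L m (m + (n + 1)) =
      Real.sqrt (((m + (n + 1) : ℕ) : ℝ) ^ 2 - (m : ℝ) ^ 2) /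
        (Real.sqrt (hcoef ϖ β L (m + (n + 1))) * Real.sqrt (hcoef ϖ β L (m + n))) := by
  unfold bcoef
  rw [Real.sqrt_div' _ (mul_pos (hpos _) (hpos _)).le, Real.sqrt_mul (hpos _).le]
  rfl

/-- Rows of a symmetric tridiagonal matrix with zero diagonal, applied to the truncation of a
sequence that vanishes just past the end. -/
lemma sum_tridiagonal_mul {N : ℕ} (b v : ℕ → ℝ) (hb : b 0 = 0) (hv : v N = 0) (i : Fin N) :
    ∑ j : Fin N, (if (i : ℕ) + 1 = j then b j else if (j : ℕ) + 1 = i then b i else 0) * v j =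
      b (i + 1) * v (i + 1) + b i * v (i - 1) := by
  obtain ⟨i, hi⟩ := i
  rw [Fin.sum_univ_eq_sum_range
    (fun j => (if i + 1 = j then b j else if j + 1 = i then b i else 0) * v j) N]
  have hsplit : ∀ j ∈ Finset.range N,
      (if i + 1 = j then b j else if j + 1 = i then b i else 0) * v j =
        (if i + 1 = j then b j * v j else 0) + (if i - 1 = j then b i * v j else 0) := by
    intro j _
    rcases Nat.eq_zero_or_pos i with rfl | hpos
    · split_ifs <;> simp_all
    · split_ifs <;> first | omega | simp
  rw [Finset.sum_congr rfl hsplit, Finset.sum_add_distrib, Finset.sum_ite_eq, Finset.sum_ite_eq,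
    if_pos (Finset.mem_range.mpr (by omega : i - 1 < N))]
  split_ifs with h
  · rfl
  · obtain rfl : i + 1 = N := by rw [Finset.mem_range] at h; omega
    simp [hv]

/-- if `g_{l_B+1}^m(ν) = 0` then the vector `v_l = √(h_l) g_l^m(ν)`,
`l ∈ {m,…,l_B}`, is a nonzero eigenvector of `B(m)` with eigenvalue `ν`. -/
theorem stmt_6 (L : ℕ) (hL : 1 ≤ L) (ϖ : ℝ) (hϖ : ϖ ∈ Set.Ioo (0 : ℝ) 1)
    (β : ℕ → ℝ) (hβ0 : β 0 = 1)
    (hβ : ∀ l : ℕ, 1 ≤ l → l ≤ L → β l ∈ Set.Ioo (0 : ℝ) (2 * (l : ℝ) + 1))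
    (m : ℕ) (hm : m ≤ L)
    (lB : ℕ) (hlB : L ≤ lB) (ν : ℝ)
    (hroot : gml ϖ β L m (lB + 1) ν = 0) :
    (fun i : Fin (lB - m + 1) =>
        Real.sqrt (hcoef ϖ β L (m + i)) * gml ϖ β L m (m + i) ν) ≠ 0 ∧
      (Bmat ϖ β L m lB).mulVec
          (fun i : Fin (lB - m + 1) =>
            Real.sqrt (hcoef ϖ β L (m + i)) * gml ϖ β L m (m + i) ν) =
        ν • fun i : Fin (lB - m + 1) =>
          Real.sqrt (hcoef ϖ β L (m + i)) * gml ϖ β L m (m + i) ν := by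
  have hpos := hcoef_pos hϖ hβ0 hβ
  have hg : ∀ n, gml ϖ β L m (m + n) ν = chandraAux ϖ β L m ν n := fun n => by simp [gml]
  have hlast : chandraAux ϖ β L m ν (lB - m + 1) = 0 := by
    rw [← hg, ← hroot]
    congr 1
    omega
  simp only [hg]
  refine ⟨fun h => ?_, ?_⟩
  · have h0 := congrFun h 0
    have hne := (Real.sqrt_pos.mpr (hpos m)).ne'
    simp [chandraAux, hne, Nat.factorial_ne_zero] at h0
  · funext i
    have hrow := sum_tridiagonal_mul (fun n => bcoef ϖ β L m (m + n))
      (fun n => Real.sqrt (hcoef ϖ β L (m + n)) * chandraAux ϖ β L m ν n)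
      (by simp [bcoef]) (by simp [hlast]) i
    refine hrow.trans ?_
    obtain ⟨n, hn⟩ := i
    have hrec := chandraAux_recurrence ϖ β L m ν n
    have hsq := Real.sq_sqrt (hpos (m + n)).le
    have hne := (Real.sqrt_pos.mpr (hpos (m + n))).ne'
    have hne' := (Real.sqrt_pos.mpr (hpos (m + (n + 1)))).ne'
    simp only [Pi.smul_apply, smul_eq_mul]
    apply mul_left_cancel₀ hne
    trans ν * hcoef ϖ β L (m + n) * chandraAux ϖ β L m ν n
    · rw [hrec, mul_add, bcoef_succ hpos]
      congr 1
      · field_simp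
      · cases n with
        | zero => simp [bcoef]
        | succ k =>
          have hk := (Real.sqrt_pos.mpr (hpos (m + k))).ne'
          rw [bcoef_succ hpos, Nat.add_sub_cancel]
          field_simp
    · linear_combination -(ν * chandraAux ϖ β L m ν n) * hsq
end
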